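/- Let Q be a commutative quantale with least element 0. If a₊ ⊗ a₋ = 0 and b₊ ⊗ b₋ = 0, then (a₊ ⊗ b₊) ⊗ (a₋ ⊔ b₋ ⊔ (a₋ ⊗ b₋)) = 0. (The containment-satisfying pairs of quantale elements are closed under the multiplication ⊗ × ∨̃ of the mixed quantale Q_⊗ × Q_⊗^∨, where ∨̃ is the join of idempotents x ∨̃ y = x ⊔ y ⊔ (x ⊗ y).) -/

import Mathlib

/-- A commutative quantale: a complete lattice with a commutative monoid operation
distributing over arbitrary suprema in each variable. -/
class CommQuantale (Q : Type*) extends CompleteLattice Q, CommMonoid Q where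
  mul_sSup : ∀ (x : Q) (s : Set Q), x * sSup s = sSup ((fun y => x * y) '' s)

instance CommQuantale.isQuantale {Q : Type*} [CommQuantale Q] : IsQuantale Q where
  mul_sSup_distrib x s := by rw [CommQuantale.mul_sSup, sSup_image]
  sSup_mul_distrib s x := by
    simp_rw [mul_comm _ x]
    rw [CommQuantale.mul_sSup, sSup_image]

/-- The containment-satisfying pairs of quantale elements are closed under the
multiplication `⊗ × ∨̃` of the mixed quantale, where `∨̃` is the join of
idempotents `x ∨̃ y = x ⊔ y ⊔ (x ⊗ y)`. -/
theorem mixed_quantale_closed {Q : Type*} [CommQuantale Q]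
    (ap am bp bm : Q)
    (ha : ap * am = (⊥ : Q)) (hb : bp * bm = (⊥ : Q)) :
    (ap * bp) * (am ⊔ bm ⊔ am * bm) = (⊥ : Q) := by
  have h₁ : ap * bp * am = ⊥ := by rw [mul_right_comm, ha, Quantale.bot_mul]
  have h₂ : ap * bp * bm = ⊥ := by rw [mul_assoc, hb, Quantale.mul_bot]
  rw [Quantale.mul_sup_distrib, Quantale.mul_sup_distrib, ← mul_assoc, h₁, h₂,
    Quantale.bot_mul, sup_idem, sup_idem]
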